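/- arXiv:1705.10690 — 5 statements merged into one kernel-verified Lean document; each statement's English description precedes it below -/
import Mathlib

section
/- For every p ∈ ℝ and r > 0, the first sine Fourier coefficient b₁ satisfies the differential equation r·∂b₁/∂r (p,r) + b₁(p,r) = −2r·∂(Mf)/∂p (p,r). -/
open MeasureTheory Real Filter Finset

/-- Circular mean of `f` over the circle of radius `r` centered at `(p, 0)` on the x-axis:
`Mf(p,r) = (1/(2π)) ∫_{-π}^{π} f(p - r sin φ, r cos φ) dφ`. -/
noncomputable def circMean (f : ℝ × ℝ → ℝ) (p r : ℝ) : ℝ :=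
  (1 / (2 * Real.pi)) * ∫ φ in (-Real.pi)..Real.pi, f (p - r * Real.sin φ, r * Real.cos φ)

/-- `k`-th cosine Fourier coefficient of the restriction of `f` to the circle of
radius `r` centered at `(p, 0)`. -/
noncomputable def fourierA (f : ℝ × ℝ → ℝ) (k : ℕ) (p r : ℝ) : ℝ :=
  (1 / Real.pi) * ∫ φ in (-Real.pi)..Real.pi,
    f (p - r * Real.sin φ, r * Real.cos φ) * Real.cos (k * φ)

/-- `k`-th sine Fourier coefficient of the restriction of `f` to the circle of
radius `r` centered at `(p, 0)`. -/
noncomputable def fourierB (f : ℝ × ℝ → ℝ) (k : ℕ) (p r : ℝ) : ℝ :=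
  (1 / Real.pi) * ∫ φ in (-Real.pi)..Real.pi,
    f (p - r * Real.sin φ, r * Real.cos φ) * Real.sin (k * φ)

/-- Differentiation under the integral sign for a weighted integral of a compactly supported
`C¹` function along a family of curves that is affine in the parameter. -/
theorem hasDerivAt_integral_comp_affine {E : Type*} [NormedAddCommGroup E] [NormedSpace ℝ E]
    {f : E → ℝ} (hf : ContDiff ℝ 1 f) (hfc : HasCompactSupport f)
    {c w : ℝ → E} {g : ℝ → ℝ} (hc : Continuous c) (hw : Continuous w) (hg : Continuous g)
    (a b t : ℝ) :
    HasDerivAt (fun s => ∫ φ in a..b, f (c φ + s • w φ) * g φ)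
      (∫ φ in a..b, fderiv ℝ f (c φ + t • w φ) (w φ) * g φ) t := by
  have hf' : Continuous (fderiv ℝ f) := hf.continuous_fderiv (by norm_num)
  have hfcont : Continuous f := hf.continuous
  obtain ⟨C, hC⟩ := (hfc.fderiv ℝ).exists_bound_of_continuous hf'
  refine (intervalIntegral.hasDerivAt_integral_of_dominated_loc_of_deriv_le
    (bound := fun φ => C * ‖w φ‖ * ‖g φ‖) (s := Set.univ) Filter.univ_mem
    (F' := fun s φ => fderiv ℝ f (c φ + s • w φ) (w φ) * g φ) ?_ ?_ ?_ ?_ ?_ ?_).2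
  · exact .of_forall fun s => Continuous.aestronglyMeasurable (by fun_prop)
  · exact Continuous.intervalIntegrable (by fun_prop) _ _
  · exact Continuous.aestronglyMeasurable (by fun_prop)
  · refine .of_forall fun φ _ s _ => ?_
    rw [norm_mul]
    gcongr
    exact (ContinuousLinearMap.le_opNorm _ _).trans (by gcongr; exact hC _)
  · exact Continuous.intervalIntegrable (by fun_prop) _ _
  · refine .of_forall fun φ _ s _ => ?_
    have h : HasDerivAt (fun s : ℝ => c φ + s • w φ) (w φ) s := by
      simpa using ((hasDerivAt_id s).smul_const (w φ)).const_add (c φ)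
    exact ((hf.differentiable (by norm_num) _).hasFDerivAt.comp_hasDerivAt s h).mul_const (g φ)

/-- The differential equation for the first sine Fourier coefficient:
`r ∂b₁/∂r + b₁ = -2r ∂(Mf)/∂p`. -/
theorem b_one_ode (f : ℝ × ℝ → ℝ) (hf : ContDiff ℝ (⊤ : ℕ∞) f)
    (hfc : HasCompactSupport f) (hfs : tsupport f ⊆ {q : ℝ × ℝ | 0 < q.2})
    (p r : ℝ) (hr : 0 < r) :
    r * deriv (fun r' => fourierB f 1 p r') r + fourierB f 1 p r
      = -2 * r * deriv (fun p' => circMean f p' r) p := by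
  have hf1 : ContDiff ℝ 1 f := hf.of_le (by exact_mod_cast le_top)
  have hf' : Continuous (fderiv ℝ f) := hf1.continuous_fderiv (by norm_num)
  have hfcont : Continuous f := hf1.continuous
  set q : ℝ → ℝ × ℝ := fun φ => (p - r * sin φ, r * cos φ) with hq
  have hqc : Continuous q := by fun_prop
  have hB := (hasDerivAt_integral_comp_affine hf1 hfc (c := fun _ => (p, 0))
    (w := fun φ => (-sin φ, cos φ)) (g := sin) (by fun_prop) (by fun_prop) continuous_sin
    (-π) π r).const_mul (1 / π)
  have hM := (hasDerivAt_integral_comp_affine hf1 hfc (c := fun φ => (-(r * sin φ), r * cos φ))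
    (w := fun _ => (1, 0)) (g := fun _ => 1) (by fun_prop) (by fun_prop) continuous_const
    (-π) π p).const_mul (1 / (2 * π))
  have eB : (fun r' => fourierB f 1 p r') = fun s => 1 / π * ∫ φ in -π..π,
      f ((p, 0) + s • (-sin φ, cos φ)) * sin φ := by
    funext s
    simp [fourierB, sub_eq_add_neg]
  have eM : (fun p' => circMean f p' r) = fun s => 1 / (2 * π) * ∫ φ in -π..π,
      f ((-(r * sin φ), r * cos φ) + s • ((1 : ℝ), (0 : ℝ))) * 1 := by
    funext s
    simp [circMean, sub_eq_neg_add]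
  have hqB (φ : ℝ) : ((p, 0) : ℝ × ℝ) + r • (-sin φ, cos φ) = q φ := by
    simp [hq, sub_eq_add_neg]
  have hqM (φ : ℝ) : (-(r * sin φ), r * cos φ) + p • ((1 : ℝ), (0 : ℝ)) = q φ := by
    simp [hq, sub_eq_neg_add]
  rw [eB, hB.deriv, eM, hM.deriv]
  simp only [hqB, hqM, mul_one]
  have hlin (φ x y : ℝ) : fderiv ℝ f (q φ) (x, y)
      = x * fderiv ℝ f (q φ) (1, 0) + y * fderiv ℝ f (q φ) (0, 1) := by
    rw [← smul_eq_mul, ← smul_eq_mul, ← map_smul, ← map_smul, ← map_add]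
    simp
  -- Integrating the `φ`-derivative of `f (q φ) * cos φ` over a full period gives zero.
  have hperiod : ∫ φ in -π..π, (fderiv ℝ f (q φ) (-(r * cos φ), -(r * sin φ)) * cos φ
      + f (q φ) * -sin φ) = 0 := by
    rw [intervalIntegral.integral_eq_sub_of_hasDerivAt (f := fun φ => f (q φ) * cos φ)]
    · simp [hq]
    · intro φ _
      have h : HasDerivAt q (-(r * cos φ), -(r * sin φ)) φ := by
        have h1 := ((hasDerivAt_sin φ).const_mul r).const_sub p
        have h2 := (hasDerivAt_cos φ).const_mul r
        rw [mul_neg] at h2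
        exact h1.prodMk h2
      exact ((hf1.differentiable (by norm_num) _).hasFDerivAt.comp_hasDerivAt φ h).mul
        (hasDerivAt_cos φ)
    · exact Continuous.intervalIntegrable (by fun_prop) _ _
  have hb : fourierB f 1 p r = 1 / π * ∫ φ in -π..π, f (q φ) * sin φ := by
    simp [fourierB, hq]
  have key : r * (∫ φ in -π..π, fderiv ℝ f (q φ) (-sin φ, cos φ) * sin φ)
      + (∫ φ in -π..π, f (q φ) * sin φ)
      + (∫ φ in -π..π, (fderiv ℝ f (q φ) (-(r * cos φ), -(r * sin φ)) * cos φ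
        + f (q φ) * -sin φ))
      = -r * ∫ φ in -π..π, fderiv ℝ f (q φ) (1, 0) := by
    rw [← intervalIntegral.integral_const_mul, ← intervalIntegral.integral_const_mul,
      ← intervalIntegral.integral_add, ← intervalIntegral.integral_add]
    · congr 1
      funext φ
      rw [hlin φ (-sin φ), hlin φ (-(r * cos φ))]
      linear_combination (-r * fderiv ℝ f (q φ) (1, 0)) * sin_sq_add_cos_sq φ
    all_goals exact Continuous.intervalIntegrable (by fun_prop) _ _
  rw [hperiod, add_zero] at key
  rw [hb]
  linear_combination (1 / π) * key
end

section
/- For every p ∈ ℝ and r > 0, the Fourier coefficients satisfy r·∂b₂/∂r (p,r) + 2·b₂(p,r) + 2r·∂a₁/∂p (p,r) = 0. -/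
open MeasureTheory Real Filter Finset

/-- Differentiation under the integral sign over a compact interval, for an integrand whose
derivative in the parameter is jointly continuous. -/
theorem hasDerivAt_intervalIntegral_of_continuous_deriv {F F' : ℝ → ℝ → ℝ} {a b x₀ : ℝ}
    (hF : ∀ x, Continuous (F x)) (hF' : Continuous (fun z : ℝ × ℝ => F' z.1 z.2))
    (hderiv : ∀ x t, HasDerivAt (fun x => F x t) (F' x t) x) :
    HasDerivAt (fun x => ∫ t in a..b, F x t) (∫ t in a..b, F' x₀ t) x₀ := by
  obtain ⟨C, hC⟩ := ((isCompact_closedBall x₀ 1).prod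
    (isCompact_uIcc (a := a) (b := b))).exists_bound_of_continuousOn hF'.continuousOn
  refine (intervalIntegral.hasDerivAt_integral_of_dominated_loc_of_deriv_le
    (F := F) (F' := F') (bound := fun _ => C) (Metric.closedBall_mem_nhds x₀ one_pos)
    (Eventually.of_forall fun x => (hF x).aestronglyMeasurable)
    ((hF x₀).intervalIntegrable a b)
    (Continuous.aestronglyMeasurable (by fun_prop))
    (Eventually.of_forall fun t ht x hx => hC (x, t) ⟨hx, Set.uIoc_subset_uIcc ht⟩)
    intervalIntegrable_const
    (Eventually.of_forall fun t _ x _ => hderiv x t)).2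

/-- The chain rule along a plane curve, in terms of the two partial derivatives. -/
theorem HasFDerivAt.hasDerivAt_comp_pair {f : ℝ × ℝ → ℝ} {f' : ℝ × ℝ →L[ℝ] ℝ} {u v : ℝ → ℝ}
    {u' v' t : ℝ} (hf : HasFDerivAt f f' (u t, v t)) (hu : HasDerivAt u u' t)
    (hv : HasDerivAt v v' t) :
    HasDerivAt (fun s => f (u s, v s)) (u' * f' (1, 0) + v' * f' (0, 1)) t := by
  have h := hf.comp_hasDerivAt t (hu.prodMk hv)
  have e : f' (u', v') = u' * f' (1, 0) + v' * f' (0, 1) := by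
    rw [← smul_eq_mul, ← smul_eq_mul, ← map_smul, ← map_smul, ← map_add]
    simp
  rw [e] at h
  exact h

/-- The differential equation `r ∂b₂/∂r + 2 b₂ + 2r ∂a₁/∂p = 0`. -/
theorem b_two_ode (f : ℝ × ℝ → ℝ) (hf : ContDiff ℝ (⊤ : ℕ∞) f)
    (hfc : HasCompactSupport f) (hfs : tsupport f ⊆ {q : ℝ × ℝ | 0 < q.2})
    (p r : ℝ) (hr : 0 < r) :
    r * deriv (fun r' => fourierB f 2 p r') r + 2 * fourierB f 2 p r
      + 2 * r * deriv (fun p' => fourierA f 1 p' r) p = 0 := by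
  have hfd : ∀ q, HasFDerivAt f (fderiv ℝ f q) q := fun q =>
    (hf.differentiable (by simp)).differentiableAt.hasFDerivAt
  have hfcont : Continuous f := hf.continuous
  have hf' : Continuous (fderiv ℝ f) := hf.continuous_fderiv (by simp)
  obtain ⟨fx, hfx⟩ : ∃ g : ℝ × ℝ → ℝ, g = fun q => fderiv ℝ f q (1, 0) := ⟨_, rfl⟩
  obtain ⟨fy, hfy⟩ : ∃ g : ℝ × ℝ → ℝ, g = fun q => fderiv ℝ f q (0, 1) := ⟨_, rfl⟩
  have hfxc : Continuous fx := by rw [hfx]; fun_prop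
  have hfyc : Continuous fy := by rw [hfy]; fun_prop
  have chain : ∀ {u v : ℝ → ℝ} {u' v' t : ℝ}, HasDerivAt u u' t → HasDerivAt v v' t →
      HasDerivAt (fun s => f (u s, v s)) (u' * fx (u t, v t) + v' * fy (u t, v t)) t := by
    intro u v u' v' t hu hv
    rw [hfx, hfy]
    exact (hfd _).hasDerivAt_comp_pair hu hv
  have hb : HasDerivAt (fun r' => fourierB f 2 p r') ((1 / π) * ∫ φ in (-π)..π,
      (-sin φ * fx (p - r * sin φ, r * cos φ) + cos φ * fy (p - r * sin φ, r * cos φ))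
        * sin (2 * φ)) r := by
    refine HasDerivAt.const_mul _ (hasDerivAt_intervalIntegral_of_continuous_deriv
      (F' := fun r φ => (-sin φ * fx (p - r * sin φ, r * cos φ)
        + cos φ * fy (p - r * sin φ, r * cos φ)) * sin (2 * φ)) ?_ ?_ ?_)
    · intro x; fun_prop
    · fun_prop
    · intro x t
      have h1 : HasDerivAt (fun x : ℝ => p - x * sin t) (-sin t) x := by
        simpa using ((hasDerivAt_id x).mul_const (sin t)).const_sub p
      have h2 : HasDerivAt (fun x : ℝ => x * cos t) (cos t) x := by
        simpa using (hasDerivAt_id x).mul_const (cos t)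
      simpa using (chain h1 h2).mul_const (sin (2 * t))
  have ha : HasDerivAt (fun p' => fourierA f 1 p' r) ((1 / π) * ∫ φ in (-π)..π,
      fx (p - r * sin φ, r * cos φ) * cos φ) p := by
    refine HasDerivAt.const_mul _ (hasDerivAt_intervalIntegral_of_continuous_deriv
      (F' := fun p φ => fx (p - r * sin φ, r * cos φ) * cos φ) ?_ ?_ ?_)
    · intro x; fun_prop
    · fun_prop
    · intro x t
      have h1 : HasDerivAt (fun x : ℝ => x - r * sin t) 1 x :=
        (hasDerivAt_id x).sub_const (r * sin t)
      simpa using (chain h1 (hasDerivAt_const x (r * cos t))).mul_const (cos t)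
  have hG : ∀ φ, HasDerivAt (fun φ => -2 * cos φ ^ 2 * f (p - r * sin φ, r * cos φ))
      (r * ((-sin φ * fx (p - r * sin φ, r * cos φ) + cos φ * fy (p - r * sin φ, r * cos φ))
        * sin (2 * φ)) + 2 * (f (p - r * sin φ, r * cos φ) * sin (2 * φ))
        + 2 * r * (fx (p - r * sin φ, r * cos φ) * cos φ)) φ := by
    intro φ
    have h1 := ((hasDerivAt_sin φ).const_mul r).const_sub p
    have h2 := (hasDerivAt_cos φ).const_mul r
    refine ((((hasDerivAt_cos φ).fun_pow 2).const_mul (-2)).fun_mul (chain h1 h2)).congr_deriv ?_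
    rw [sin_two_mul]
    push_cast
    linear_combination (2 * r * cos φ * fx (p - r * sin φ, r * cos φ)) * sin_sq_add_cos_sq φ
  have hint := intervalIntegral.integral_eq_sub_of_hasDerivAt (a := -π) (b := π)
    (fun φ _ => hG φ) (Continuous.intervalIntegrable (by fun_prop) _ _)
  rw [intervalIntegral.integral_add (Continuous.intervalIntegrable (by fun_prop) _ _)
      (Continuous.intervalIntegrable (by fun_prop) _ _),
    intervalIntegral.integral_add (Continuous.intervalIntegrable (by fun_prop) _ _)
      (Continuous.intervalIntegrable (by fun_prop) _ _)] at hint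
  simp only [intervalIntegral.integral_const_mul, sin_neg, cos_neg, sin_pi, neg_zero,
    sub_self] at hint
  rw [hb.deriv, ha.deriv]
  simp only [fourierB, Nat.cast_ofNat]
  linear_combination (1 / π) * hint
end

section
/- For every p ∈ ℝ and r > 0, the Fourier coefficients satisfy r·∂a₂/∂r (p,r) + 2·a₂(p,r) − 2r·∂b₁/∂p (p,r) = 2r·∂(Mf)/∂r (p,r). -/
open MeasureTheory Real Filter Finset

/-- Differentiation under the integral sign over a compact interval, for a jointly continuous
partial derivative. -/
theorem hasDerivAt_intervalIntegral_of_continuous {G G' : ℝ → ℝ → ℝ} (a b x₀ : ℝ)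
    (hG : ∀ x, Continuous (G x)) (hG' : Continuous (Function.uncurry G'))
    (hd : ∀ x t, HasDerivAt (fun y => G y t) (G' x t) x) :
    HasDerivAt (fun x => ∫ t in a..b, G x t) (∫ t in a..b, G' x₀ t) x₀ := by
  obtain ⟨C, hC⟩ := ((isCompact_closedBall x₀ 1).prod (isCompact_uIcc (a := a) (b := b))
    ).exists_bound_of_continuousOn hG'.continuousOn
  refine (intervalIntegral.hasDerivAt_integral_of_dominated_loc_of_deriv_le (bound := fun _ => C)
    (Metric.closedBall_mem_nhds x₀ one_pos) (.of_forall fun x => (hG x).aestronglyMeasurable)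
    ((hG x₀).intervalIntegrable a b)
    (hG'.comp (Continuous.prodMk_right x₀)).aestronglyMeasurable
    (.of_forall fun t ht x hx => hC (x, t) ⟨hx, Set.uIoc_subset_uIcc ht⟩)
    intervalIntegrable_const (.of_forall fun t _ x _ => hd x t)).2

/-- The chain rule along a plane curve, in terms of the two partial derivatives. -/
theorem hasDerivAt_comp_prodMk {f : ℝ × ℝ → ℝ} (hf : Differentiable ℝ f) {u v : ℝ → ℝ}
    {u' v' t : ℝ} (hu : HasDerivAt u u' t) (hv : HasDerivAt v v' t) :
    HasDerivAt (fun s => f (u s, v s))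
      (u' * fderiv ℝ f (u t, v t) (1, 0) + v' * fderiv ℝ f (u t, v t) (0, 1)) t := by
  have h := (hf (u t, v t)).hasFDerivAt.comp_hasDerivAt t (hu.prodMk hv)
  rwa [show ((u', v') : ℝ × ℝ) = u' • (1, 0) + v' • (0, 1) by simp, map_add, map_smul,
    map_smul] at h

/-- The differential equation `r ∂a₂/∂r + 2 a₂ - 2r ∂b₁/∂p = 2r ∂(Mf)/∂r`. -/
theorem a_two_ode (f : ℝ × ℝ → ℝ) (hf : ContDiff ℝ (⊤ : ℕ∞) f)
    (hfc : HasCompactSupport f) (hfs : tsupport f ⊆ {q : ℝ × ℝ | 0 < q.2})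
    (p r : ℝ) (hr : 0 < r) :
    r * deriv (fun r' => fourierA f 2 p r') r + 2 * fourierA f 2 p r
      - 2 * r * deriv (fun p' => fourierB f 1 p' r) p
      = 2 * r * deriv (fun r' => circMean f p r') r := by
  have hd : Differentiable ℝ f := hf.differentiable (by simp)
  have hf₀ : Continuous f := hf.continuous
  have hf₁ : Continuous (fderiv ℝ f) := hf.continuous_fderiv (by simp)
  set gx : ℝ × ℝ → ℝ := fun q => fderiv ℝ f q (1, 0)
  set gy : ℝ × ℝ → ℝ := fun q => fderiv ℝ f q (0, 1)
  have cx : Continuous gx := hf₁.clm_apply continuous_const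
  have cy : Continuous gy := hf₁.clm_apply continuous_const
  have dr (w : ℝ → ℝ) (hw : Continuous w) :
      HasDerivAt (fun r' => ∫ φ in (-π)..π, f (p - r' * sin φ, r' * cos φ) * w φ)
        (∫ φ in (-π)..π, (-sin φ * gx (p - r * sin φ, r * cos φ)
          + cos φ * gy (p - r * sin φ, r * cos φ)) * w φ) r := by
    refine hasDerivAt_intervalIntegral_of_continuous
      (G' := fun r φ => (-sin φ * gx (p - r * sin φ, r * cos φ)
          + cos φ * gy (p - r * sin φ, r * cos φ)) * w φ) _ _ _ (fun x => by fun_prop)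
      (by unfold Function.uncurry; fun_prop) fun x φ => ?_
    refine (hasDerivAt_comp_prodMk hd ?_ ?_).mul_const (w φ)
    · simpa using ((hasDerivAt_id x).mul_const (sin φ)).const_sub p
    · simpa using (hasDerivAt_id x).mul_const (cos φ)
  have dp : HasDerivAt (fun p' => ∫ φ in (-π)..π, f (p' - r * sin φ, r * cos φ) * sin φ)
        (∫ φ in (-π)..π, gx (p - r * sin φ, r * cos φ) * sin φ) p := by
    refine hasDerivAt_intervalIntegral_of_continuous
      (G' := fun p φ => gx (p - r * sin φ, r * cos φ) * sin φ) _ _ _ (fun x => by fun_prop)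
      (by unfold Function.uncurry; fun_prop) fun x φ => ?_
    have h := (hasDerivAt_comp_prodMk hd ((hasDerivAt_id x).sub_const (r * sin φ))
      (hasDerivAt_const x (r * cos φ))).mul_const (sin φ)
    simpa using h
  have parts : ∫ φ in (-π)..π, f (p - r * sin φ, r * cos φ) * (2 * cos (2 * φ))
      = -∫ φ in (-π)..π, (-(r * cos φ) * gx (p - r * sin φ, r * cos φ)
          + -(r * sin φ) * gy (p - r * sin φ, r * cos φ)) * sin (2 * φ) := by
    rw [intervalIntegral.integral_mul_deriv_eq_deriv_mul
      (u := fun φ => f (p - r * sin φ, r * cos φ)) (v := fun φ => sin (2 * φ))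
      (u' := fun φ => -(r * cos φ) * gx (p - r * sin φ, r * cos φ)
          + -(r * sin φ) * gy (p - r * sin φ, r * cos φ))]
    · simp [sin_two_mul]
    · refine fun φ _ => hasDerivAt_comp_prodMk hd ?_ ?_
      · exact ((hasDerivAt_sin φ).const_mul r).const_sub p
      · simpa using (hasDerivAt_cos φ).const_mul r
    · intro φ _
      simpa [mul_comm] using ((hasDerivAt_id φ).const_mul 2).sin
    · exact Continuous.intervalIntegrable (by fun_prop) _ _
    · exact Continuous.intervalIntegrable (by fun_prop) _ _
  have hA : deriv (fun r' => fourierA f 2 p r') r = _ :=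
    ((dr (fun φ => cos ((2 : ℕ) * φ)) (by fun_prop)).const_mul (1 / π)).deriv
  have hB : deriv (fun p' => fourierB f 1 p' r) p
      = 1 / π * ∫ φ in (-π)..π, gx (p - r * sin φ, r * cos φ) * sin φ := by
    simpa [fourierB] using (dp.const_mul (1 / π)).deriv
  have hM : deriv (fun r' => circMean f p r') r
      = 1 / (2 * π) * ∫ φ in (-π)..π, (-sin φ * gx (p - r * sin φ, r * cos φ)
          + cos φ * gy (p - r * sin φ, r * cos φ)) := by
    simpa [circMean] using ((dr (fun _ => 1) continuous_const).const_mul (1 / (2 * π))).deriv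
  have hF : 2 * fourierA f 2 p r
      = 1 / π * ∫ φ in (-π)..π, f (p - r * sin φ, r * cos φ) * (2 * cos (2 * φ)) := by
    rw [fourierA, mul_left_comm, ← intervalIntegral.integral_const_mul]
    simp only [Nat.cast_ofNat, mul_left_comm]
  have key : r * (∫ φ in (-π)..π, (-sin φ * gx (p - r * sin φ, r * cos φ)
          + cos φ * gy (p - r * sin φ, r * cos φ)) * cos (2 * φ))
      + -(∫ φ in (-π)..π, (-(r * cos φ) * gx (p - r * sin φ, r * cos φ)
          + -(r * sin φ) * gy (p - r * sin φ, r * cos φ)) * sin (2 * φ))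
      - 2 * r * (∫ φ in (-π)..π, gx (p - r * sin φ, r * cos φ) * sin φ)
      = r * ∫ φ in (-π)..π, (-sin φ * gx (p - r * sin φ, r * cos φ)
          + cos φ * gy (p - r * sin φ, r * cos φ)) := by
    simp only [← intervalIntegral.integral_const_mul, ← intervalIntegral.integral_neg]
    rw [← intervalIntegral.integral_add, ← intervalIntegral.integral_sub]
    · congr 1
      ext φ
      rw [sin_two_mul, cos_two_mul]
      linear_combination (2 * r * cos φ * gy (p - r * sin φ, r * cos φ)) * sin_sq_add_cos_sq φ
    all_goals exact Continuous.intervalIntegrable (by fun_prop) _ _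
  rw [hA, hB, hM, hF, parts]
  simp only [Nat.cast_ofNat]
  linear_combination (1 / π) * key
end

section
/- For every integer k ≥ 3, every p ∈ ℝ and every r > 0, the Fourier coefficients satisfy the recurrence r·∂b_k/∂r (p,r) + k·b_k(p,r) − r·∂b_{k−2}/∂r (p,r) + (k−2)·b_{k−2}(p,r) + 2r·∂a_{k−1}/∂p (p,r) = 0. -/
open MeasureTheory Real Filter Finset

/-- Differentiation under the integral sign along a family of affine lines, for a compactly supported
`C¹` function with a continuous weight. -/
lemma hasDerivAt_integral_comp_line {E : Type*} [NormedAddCommGroup E] [NormedSpace ℝ E]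
    {f : E → ℝ} (hf : ContDiff ℝ 1 f) (hfc : HasCompactSupport f) {q v : ℝ → E} {w : ℝ → ℝ}
    (hq : Continuous q) (hv : Continuous v) (hw : Continuous w) (a b t₀ : ℝ) :
    HasDerivAt (fun t => ∫ φ in a..b, f (q φ + t • v φ) * w φ)
      (∫ φ in a..b, fderiv ℝ f (q φ + t₀ • v φ) (v φ) * w φ) t₀ := by
  have hf' : Continuous (fderiv ℝ f) := hf.continuous_fderiv one_ne_zero
  have hf0 := hf.continuous
  obtain ⟨C, hC⟩ := hf'.bounded_above_of_compact_support (hfc.fderiv ℝ)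
  refine (intervalIntegral.hasDerivAt_integral_of_dominated_loc_of_deriv_le
    (F' := fun t φ => fderiv ℝ f (q φ + t • v φ) (v φ) * w φ)
    (bound := fun φ => C * ‖v φ‖ * ‖w φ‖) Filter.univ_mem ?_ ?_ ?_ ?_ ?_ ?_).2
  · exact .of_forall fun t => Continuous.aestronglyMeasurable (by fun_prop)
  · exact Continuous.intervalIntegrable (by fun_prop) _ _
  · exact Continuous.aestronglyMeasurable (by fun_prop)
  · refine .of_forall fun φ _ t _ => ?_
    rw [norm_mul]
    gcongr
    exact (fderiv ℝ f _).le_of_opNorm_le (hC _) _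
  · exact Continuous.intervalIntegrable (by fun_prop) _ _
  · refine .of_forall fun φ _ t _ => HasDerivAt.mul_const ?_ _
    have hline : HasDerivAt (fun t : ℝ => q φ + t • v φ) (v φ) t := by
      simpa using ((hasDerivAt_id t).smul_const (v φ)).const_add (q φ)
    exact (hf.differentiable one_ne_zero _).hasFDerivAt.comp_hasDerivAt t hline

lemma hasDerivAt_fourierB_radius {f : ℝ × ℝ → ℝ} (hf : ContDiff ℝ 1 f)
    (hfc : HasCompactSupport f) (k : ℕ) (p r : ℝ) :
    HasDerivAt (fun r' => fourierB f k p r')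
      ((1 / Real.pi) * ∫ φ in (-Real.pi)..Real.pi,
        fderiv ℝ f (p - r * Real.sin φ, r * Real.cos φ) (-Real.sin φ, Real.cos φ)
          * Real.sin (k * φ)) r := by
  have h := (hasDerivAt_integral_comp_line hf hfc (q := fun _ => (p, 0))
    (v := fun φ => (-Real.sin φ, Real.cos φ)) (w := fun φ => Real.sin (k * φ))
    (by fun_prop) (by fun_prop) (by fun_prop) (-Real.pi) Real.pi r).const_mul (1 / Real.pi)
  simpa [fourierB, ← sub_eq_add_neg] using h

lemma hasDerivAt_fourierA_center {f : ℝ × ℝ → ℝ} (hf : ContDiff ℝ 1 f)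
    (hfc : HasCompactSupport f) (k : ℕ) (p r : ℝ) :
    HasDerivAt (fun p' => fourierA f k p' r)
      ((1 / Real.pi) * ∫ φ in (-Real.pi)..Real.pi,
        fderiv ℝ f (p - r * Real.sin φ, r * Real.cos φ) (1, 0) * Real.cos (k * φ)) p := by
  have h := (hasDerivAt_integral_comp_line hf hfc
    (q := fun φ => (-(r * Real.sin φ), r * Real.cos φ))
    (v := fun _ => (1, 0)) (w := fun φ => Real.cos (k * φ))
    (by fun_prop) (by fun_prop) (by fun_prop) (-Real.pi) Real.pi p).const_mul (1 / Real.pi)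
  simpa [fourierA, neg_add_eq_sub] using h

/-- Integration by parts on the circle; the boundary terms cancel by periodicity. -/
lemma natCast_mul_fourierB {f : ℝ × ℝ → ℝ} (hf : ContDiff ℝ 1 f) (k : ℕ) (p r : ℝ) :
    (k : ℝ) * fourierB f k p r = (1 / Real.pi) * ∫ φ in (-Real.pi)..Real.pi,
      fderiv ℝ f (p - r * Real.sin φ, r * Real.cos φ) (-(r * Real.cos φ), -(r * Real.sin φ))
        * Real.cos (k * φ) := by
  have hf' : Continuous (fderiv ℝ f) := hf.continuous_fderiv one_ne_zero
  have hf0 := hf.continuous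
  have hF (φ : ℝ) : HasDerivAt (fun φ => f (p - r * Real.sin φ, r * Real.cos φ))
      (fderiv ℝ f (p - r * Real.sin φ, r * Real.cos φ)
        (-(r * Real.cos φ), -(r * Real.sin φ))) φ := by
    have hcurve : HasDerivAt (fun φ => (p - r * Real.sin φ, r * Real.cos φ))
        (-(r * Real.cos φ), -(r * Real.sin φ)) φ := by
      simpa using (((Real.hasDerivAt_sin φ).const_mul r).const_sub p).prodMk
        ((Real.hasDerivAt_cos φ).const_mul r)
    exact (hf.differentiable one_ne_zero _).hasFDerivAt.comp_hasDerivAt φ hcurve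
  have hG (φ : ℝ) : HasDerivAt (fun φ => Real.cos (k * φ)) (-(k * Real.sin (k * φ))) φ := by
    simpa [mul_comm] using ((hasDerivAt_id φ).const_mul (k : ℝ)).cos
  have h := intervalIntegral.integral_deriv_mul_eq_sub (a := -Real.pi) (b := Real.pi)
    (fun φ _ => hF φ) (fun φ _ => hG φ)
    (Continuous.intervalIntegrable (by fun_prop) _ _)
    (Continuous.intervalIntegrable (by fun_prop) _ _)
  rw [intervalIntegral.integral_add (Continuous.intervalIntegrable (by fun_prop) _ _)
    (Continuous.intervalIntegrable (by fun_prop) _ _)] at h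
  simp only [Real.sin_neg, Real.cos_neg, Real.sin_pi, Real.cos_pi, neg_zero, mul_neg, sub_self,
    intervalIntegral.integral_neg] at h
  rw [← sub_eq_add_neg, sub_eq_zero] at h
  rw [h, fourierB, mul_left_comm, ← intervalIntegral.integral_const_mul]
  congr 2
  ext φ
  ring

/-- The recurrence for sine coefficients, `k ≥ 3`:
`r ∂b_k/∂r + k b_k - r ∂b_{k-2}/∂r + (k-2) b_{k-2} + 2r ∂a_{k-1}/∂p = 0`. -/
theorem b_k_recurrence (f : ℝ × ℝ → ℝ) (hf : ContDiff ℝ (⊤ : ℕ∞) f)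
    (hfc : HasCompactSupport f) (hfs : tsupport f ⊆ {q : ℝ × ℝ | 0 < q.2})
    (k : ℕ) (hk : 3 ≤ k) (p r : ℝ) (hr : 0 < r) :
    r * deriv (fun r' => fourierB f k p r') r + (k : ℝ) * fourierB f k p r
      - r * deriv (fun r' => fourierB f (k - 2) p r') r
      + ((k : ℝ) - 2) * fourierB f (k - 2) p r
      + 2 * r * deriv (fun p' => fourierA f (k - 1) p' r) p = 0 := by
  obtain ⟨m, rfl⟩ : ∃ m, k = m + 2 := ⟨k - 2, by omega⟩
  have hf1 : ContDiff ℝ 1 f := hf.of_le (by exact_mod_cast le_top)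
  have hf' : Continuous (fderiv ℝ f) := hf1.continuous_fderiv one_ne_zero
  have hcast : ((m + 2 : ℕ) : ℝ) - 2 = (m : ℝ) := by push_cast; ring
  rw [show m + 2 - 2 = m by omega, show m + 2 - 1 = m + 1 by omega, hcast,
    (hasDerivAt_fourierB_radius hf1 hfc _ p r).deriv,
    (hasDerivAt_fourierB_radius hf1 hfc _ p r).deriv,
    (hasDerivAt_fourierA_center hf1 hfc _ p r).deriv,
    natCast_mul_fourierB hf1, natCast_mul_fourierB hf1]
  simp only [mul_left_comm _ (1 / Real.pi)]
  rw [← mul_add, ← mul_sub, ← mul_add, ← mul_add]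
  simp only [← intervalIntegral.integral_const_mul]
  rw [← intervalIntegral.integral_add, ← intervalIntegral.integral_sub,
    ← intervalIntegral.integral_add, ← intervalIntegral.integral_add]
  · refine mul_eq_zero_of_right _ (intervalIntegral.integral_zero_ae (.of_forall fun φ _ => ?_))
    have hL (x y : ℝ) : fderiv ℝ f (p - r * Real.sin φ, r * Real.cos φ) (x, y) =
        x * fderiv ℝ f (p - r * Real.sin φ, r * Real.cos φ) (1, 0) +
        y * fderiv ℝ f (p - r * Real.sin φ, r * Real.cos φ) (0, 1) := by
      simp only [← smul_eq_mul (a := x), ← smul_eq_mul (a := y), ← map_smul, ← map_add]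
      simp
    have hadd : ((m + 2 : ℕ) : ℝ) * φ = ((m + 1 : ℕ) : ℝ) * φ + φ := by push_cast; ring
    have hsub : (m : ℝ) * φ = ((m + 1 : ℕ) : ℝ) * φ - φ := by push_cast; ring
    rw [hL (-Real.sin φ), hL (-(r * Real.cos φ)), hadd, hsub, Real.sin_add, Real.cos_add,
      Real.sin_sub, Real.cos_sub]
    linear_combination (-2 * r * Real.cos (((m + 1 : ℕ) : ℝ) * φ) *
      fderiv ℝ f (p - r * Real.sin φ, r * Real.cos φ) (1, 0)) * Real.sin_sq_add_cos_sq φ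
  all_goals exact Continuous.intervalIntegrable (by fun_prop) _ _
end

section
/- Let f and g be infinitely differentiable functions ℝ² → ℝ whose supports are compact subsets of the open upper half-plane {(x,y) : y > 0}. Fix x ∈ ℝ, y > 0 and ε > 0. If Mf(p,r) = Mg(p,r) for all p with |p − x| < ε and all r with 0 ≤ r ≤ y, then f(x,y) = g(x,y). In other words, the reconstruction of f at (x,y) is local: f(x,y) depends only on the values of Mf for centers in a neighborhood of (x,0) on the line and radii r ∈ [0,y]. -/
open MeasureTheory Real Filter Finset

theorem hasDerivAt_intervalIntegral_of_continuous_s18 {F F' : ℝ → ℝ → ℝ} {a b : ℝ}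
    (hF : Continuous (Function.uncurry F)) (hF' : Continuous (Function.uncurry F'))
    (hderiv : ∀ s t, HasDerivAt (fun s ↦ F s t) (F' s t) s) (s₀ : ℝ) :
    HasDerivAt (fun s ↦ ∫ t in a..b, F s t) (∫ t in a..b, F' s₀ t) s₀ := by
  obtain ⟨C, hC⟩ := ((isCompact_closedBall s₀ 1).prod (isCompact_uIcc (a := a) (b := b))
    ).exists_bound_of_continuousOn hF'.continuousOn
  have hFs (s : ℝ) : Continuous (F s) := hF.comp (by fun_prop : Continuous fun t : ℝ ↦ (s, t))
  have hFs' (s : ℝ) : Continuous (F' s) := hF'.comp (by fun_prop : Continuous fun t : ℝ ↦ (s, t))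
  refine (intervalIntegral.hasDerivAt_integral_of_dominated_loc_of_deriv_le
    (bound := fun _ ↦ C) (Metric.closedBall_mem_nhds s₀ one_pos)
    (.of_forall fun s ↦ (hFs s).aestronglyMeasurable) ((hFs s₀).intervalIntegrable _ _)
    (hFs' s₀).aestronglyMeasurable (.of_forall fun t ht s hs ↦ ?_)
    intervalIntegrable_const (.of_forall fun t _ s _ ↦ hderiv s t)).2
  exact hC (s, t) ⟨hs, Set.uIoc_subset_uIcc ht⟩

section CircleIntegrals

variable {u : ℝ × ℝ → ℝ}

theorem hasDerivAt_circle_center (hu : ContDiff ℝ 1 u) (p r : ℝ) :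
    HasDerivAt (fun p ↦ ∫ φ in (-π)..π, u (p - r * sin φ, r * cos φ))
      (∫ φ in (-π)..π, fderiv ℝ u (p - r * sin φ, r * cos φ) (1, 0)) p := by
  have hu' := hu.continuous_fderiv one_ne_zero
  refine hasDerivAt_intervalIntegral_of_continuous_s18
    (F := fun p φ ↦ u (p - r * sin φ, r * cos φ))
    (F' := fun p φ ↦ fderiv ℝ u (p - r * sin φ, r * cos φ) (1, 0))
    (by have := hu.continuous; fun_prop) (by fun_prop) (fun s t ↦ ?_) p
  exact (hu.differentiable one_ne_zero _).hasFDerivAt.comp_hasDerivAt s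
    (((hasDerivAt_id s).sub_const _).prodMk (hasDerivAt_const s _))

theorem hasDerivAt_circle_radius (hu : ContDiff ℝ 1 u) (p r : ℝ) :
    HasDerivAt (fun r ↦ ∫ φ in (-π)..π, sin φ * u (p - r * sin φ, r * cos φ))
      (∫ φ in (-π)..π, sin φ * fderiv ℝ u (p - r * sin φ, r * cos φ) (-sin φ, cos φ)) r := by
  have hu' := hu.continuous_fderiv one_ne_zero
  refine hasDerivAt_intervalIntegral_of_continuous_s18
    (F := fun r φ ↦ sin φ * u (p - r * sin φ, r * cos φ))
    (F' := fun r φ ↦ sin φ * fderiv ℝ u (p - r * sin φ, r * cos φ) (-sin φ, cos φ))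
    (by have := hu.continuous; fun_prop) (by fun_prop) (fun s t ↦ ?_) r
  have hcurve : HasDerivAt (fun s ↦ (p - s * sin t, s * cos t)) (-sin t, cos t) s := by
    simpa using (((hasDerivAt_id s).mul_const (sin t)).const_sub p).prodMk
      ((hasDerivAt_id s).mul_const (cos t))
  exact ((hu.differentiable one_ne_zero _).hasFDerivAt.comp_hasDerivAt s hcurve).const_mul (sin t)

theorem hasDerivAt_circle_angle (hu : ContDiff ℝ 1 u) (p r φ : ℝ) :
    HasDerivAt (fun φ ↦ u (p - r * sin φ, r * cos φ))
      (fderiv ℝ u (p - r * sin φ, r * cos φ) (-(r * cos φ), -(r * sin φ))) φ := by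
  have hcurve : HasDerivAt (fun φ ↦ (p - r * sin φ, r * cos φ))
      (-(r * cos φ), -(r * sin φ)) φ := by
    simpa using (((hasDerivAt_sin φ).const_mul r).const_sub p).prodMk
      ((hasDerivAt_cos φ).const_mul r)
  exact (hu.differentiable one_ne_zero _).hasFDerivAt.comp_hasDerivAt φ hcurve

theorem integral_sin_mul_circle (hu : ContDiff ℝ 1 u) (p r : ℝ) :
    ∫ φ in (-π)..π, sin φ * u (p - r * sin φ, r * cos φ) =
      ∫ φ in (-π)..π, cos φ *
        fderiv ℝ u (p - r * sin φ, r * cos φ) (-(r * cos φ), -(r * sin φ)) := by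
  have hu' := hu.continuous_fderiv one_ne_zero
  have huc := hu.continuous
  have key := intervalIntegral.integral_mul_deriv_eq_deriv_mul (a := -π) (b := π)
    (fun φ _ ↦ hasDerivAt_cos φ)
    (fun φ _ ↦ hasDerivAt_circle_angle hu p r φ)
    (Continuous.intervalIntegrable (by fun_prop) _ _)
    (Continuous.intervalIntegrable (by fun_prop) _ _)
  simp only [neg_mul, intervalIntegral.integral_neg] at key
  simp [key]

/-- The infinitesimal form of the divergence theorem on disks centered on the first axis. -/
theorem hasDerivAt_mul_integral_sin_mul_circle (hu : ContDiff ℝ 1 u) (p r : ℝ) :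
    HasDerivAt (fun r ↦ r * ∫ φ in (-π)..π, sin φ * u (p - r * sin φ, r * cos φ))
      (-(r * ∫ φ in (-π)..π, fderiv ℝ u (p - r * sin φ, r * cos φ) (1, 0))) r := by
  have hu' := hu.continuous_fderiv one_ne_zero
  refine ((hasDerivAt_id r).mul (hasDerivAt_circle_radius hu p r)).congr_deriv ?_
  simp only [id, one_mul]
  rw [integral_sin_mul_circle hu, ← intervalIntegral.integral_const_mul,
    ← intervalIntegral.integral_const_mul, ← intervalIntegral.integral_neg,
    ← intervalIntegral.integral_add (Continuous.intervalIntegrable (by fun_prop) _ _)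
      (Continuous.intervalIntegrable (by fun_prop) _ _)]
  refine intervalIntegral.integral_congr fun φ _ ↦ ?_
  have expand (a b : ℝ) (q : ℝ × ℝ) :
      fderiv ℝ u q (a, b) = a * fderiv ℝ u q (1, 0) + b * fderiv ℝ u q (0, 1) := by
    rw [← smul_eq_mul, ← smul_eq_mul, ← map_smul, ← map_smul, ← map_add]
    simp
  rw [expand (-(r * cos φ)), expand (-sin φ)]
  linear_combination (-r * fderiv ℝ u (p - r * sin φ, r * cos φ) (1, 0)) * sin_sq_add_cos_sq φ

/-- Vanishing of circle integrals for nearby centers and small radii is preserved under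
multiplication by the first coordinate. -/
theorem integral_circle_fst_mul_eq_zero (hu : ContDiff ℝ 1 u) {x y ε : ℝ}
    (h : ∀ p r : ℝ, |p - x| < ε → 0 ≤ r → r ≤ y →
      ∫ φ in (-π)..π, u (p - r * sin φ, r * cos φ) = 0)
    (p r : ℝ) (hp : |p - x| < ε) (hr : 0 ≤ r) (hry : r ≤ y) :
    ∫ φ in (-π)..π, (p - r * sin φ) * u (p - r * sin φ, r * cos φ) = 0 := by
  have huc := hu.continuous
  have hfx (s : ℝ) (hs : 0 ≤ s) (hsy : s ≤ y) :
      ∫ φ in (-π)..π, fderiv ℝ u (p - s * sin φ, s * cos φ) (1, 0) = 0 := by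
    refine (hasDerivAt_circle_center hu p s).unique
      ((hasDerivAt_const p (0 : ℝ)).congr_of_eventuallyEq ?_)
    filter_upwards [(isOpen_lt (by fun_prop : Continuous fun p : ℝ ↦ |p - x|)
      continuous_const).mem_nhds hp] with q hq
    exact h q s hq hs hsy
  have hD (s : ℝ) := hasDerivAt_mul_integral_sin_mul_circle hu p s
  have hconst := constant_of_has_deriv_right_zero (a := 0) (b := y)
    (f := fun r ↦ r * ∫ φ in (-π)..π, sin φ * u (p - r * sin φ, r * cos φ))
    (fun s _ ↦ (hD s).continuousAt.continuousWithinAt)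
    (fun s hs ↦ by simpa [hfx s hs.1 hs.2.le] using (hD s).hasDerivWithinAt (s := Set.Ici s))
    r ⟨hr, hry⟩
  simp only [zero_mul] at hconst
  simp only [sub_mul, mul_assoc]
  rw [intervalIntegral.integral_sub (Continuous.intervalIntegrable (by fun_prop) _ _)
      (Continuous.intervalIntegrable (by fun_prop) _ _), intervalIntegral.integral_const_mul,
    intervalIntegral.integral_const_mul, h p r hp hr hry, hconst, mul_zero, sub_zero]

theorem integral_circle_polynomial_mul_eq_zero (hu : ContDiff ℝ 1 u) {x y ε : ℝ}
    (h : ∀ p r : ℝ, |p - x| < ε → 0 ≤ r → r ≤ y →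
      ∫ φ in (-π)..π, u (p - r * sin φ, r * cos φ) = 0) (P : Polynomial ℝ) :
    ∀ p r : ℝ, |p - x| < ε → 0 ≤ r → r ≤ y →
      ∫ φ in (-π)..π, P.eval (p - r * sin φ) * u (p - r * sin φ, r * cos φ) = 0 := by
  have huc := hu.continuous
  induction P using Polynomial.induction_on with
  | C a =>
    intro p r hp hr hry
    simp [h p r hp hr hry]
  | add P Q hP hQ =>
    intro p r hp hr hry
    simp only [Polynomial.eval_add, add_mul]
    rw [intervalIntegral.integral_add (Continuous.intervalIntegrable (by fun_prop) _ _)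
      (Continuous.intervalIntegrable (by fun_prop) _ _), hP p r hp hr hry, hQ p r hp hr hry,
      add_zero]
  | monomial n a ih =>
    intro p r hp hr hry
    have hPu : ContDiff ℝ 1 fun q : ℝ × ℝ ↦
        (Polynomial.C a * Polynomial.X ^ n).eval q.1 * u q := by
      simp only [Polynomial.eval_mul, Polynomial.eval_C, Polynomial.eval_pow, Polynomial.eval_X]
      fun_prop
    rw [← integral_circle_fst_mul_eq_zero hPu ih p r hp hr hry]
    refine intervalIntegral.integral_congr fun φ _ ↦ ?_
    simp only [Polynomial.eval_mul, Polynomial.eval_C, Polynomial.eval_pow, Polynomial.eval_X]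
    ring

theorem integral_circle_continuous_mul_eq_zero (hu : ContDiff ℝ 1 u) {x y ε : ℝ}
    (h : ∀ p r : ℝ, |p - x| < ε → 0 ≤ r → r ≤ y →
      ∫ φ in (-π)..π, u (p - r * sin φ, r * cos φ) = 0)
    (p r : ℝ) (hp : |p - x| < ε) (hr : 0 ≤ r) (hry : r ≤ y)
    {w : ℝ → ℝ} (hw : Continuous w) :
    ∫ φ in (-π)..π, w (p - r * sin φ) * u (p - r * sin φ, r * cos φ) = 0 := by
  have huc := hu.continuous
  obtain ⟨C, hC⟩ := (isCompact_uIcc (a := -π) (b := π)).exists_bound_of_continuousOn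
    (f := fun φ ↦ u (p - r * sin φ, r * cos φ)) (Continuous.continuousOn (by fun_prop))
  have hC0 : 0 ≤ C := (norm_nonneg _).trans (hC _ Set.left_mem_uIcc)
  have hbound (δ : ℝ) (hδ : 0 < δ) :
      |∫ φ in (-π)..π, w (p - r * sin φ) * u (p - r * sin φ, r * cos φ)|
        ≤ C * (2 * π) * δ := by
    obtain ⟨P, hP⟩ := exists_polynomial_near_of_continuousOn (p - r) (p + r) w
      hw.continuousOn δ hδ
    have hdiff : ∫ φ in (-π)..π, w (p - r * sin φ) * u (p - r * sin φ, r * cos φ) =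
        ∫ φ in (-π)..π, (w (p - r * sin φ) - P.eval (p - r * sin φ)) *
          u (p - r * sin φ, r * cos φ) := by
      simp only [sub_mul]
      rw [intervalIntegral.integral_sub (Continuous.intervalIntegrable (by fun_prop) _ _)
        (Continuous.intervalIntegrable (by fun_prop) _ _),
        integral_circle_polynomial_mul_eq_zero hu h P p r hp hr hry, sub_zero]
    rw [hdiff, ← Real.norm_eq_abs]
    refine (intervalIntegral.norm_integral_le_of_norm_le_const (C := δ * C) fun φ hφ ↦ ?_).trans
      (le_of_eq ?_)
    · rw [norm_mul]
      refine mul_le_mul ?_ (hC φ (Set.uIoc_subset_uIcc hφ)) (norm_nonneg _) hδ.le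
      rw [Real.norm_eq_abs, abs_sub_comm]
      refine (hP _ ⟨?_, ?_⟩).le <;> nlinarith [sin_le_one φ, neg_one_le_sin φ]
    · rw [sub_neg_eq_add, ← two_mul, abs_of_pos two_pi_pos]
      ring
  have hK : 0 < C * (2 * π) + 1 := by positivity
  refine abs_nonpos_iff.1 (le_of_forall_pos_le_add fun δ hδ ↦ ?_)
  refine (hbound _ (div_pos hδ hK)).trans ?_
  rw [zero_add, ← mul_div_assoc, div_le_iff₀ hK]
  nlinarith

/-- A function vanishing on the lower half-plane is determined at `(x, y)` by its integrals over
circles with centers near `(x, 0)` and radii at most `y`. -/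
theorem eq_zero_of_integral_circle_eq_zero (hu : ContDiff ℝ 1 u)
    (hsupp : ∀ q : ℝ × ℝ, q.2 ≤ 0 → u q = 0) {x y ε : ℝ} (hy : 0 < y) (hε : 0 < ε)
    (h : ∀ p r : ℝ, |p - x| < ε → 0 ≤ r → r ≤ y →
      ∫ φ in (-π)..π, u (p - r * sin φ, r * cos φ) = 0) :
    u (x, y) = 0 := by
  have huc := hu.continuous
  have hint := integral_circle_continuous_mul_eq_zero hu h x y (by simpa using hε) hy.le le_rfl
    (w := fun t ↦ u (t, √(y ^ 2 - (t - x) ^ 2))) (by fun_prop)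
  by_contra hne
  refine (intervalIntegral.integral_pos (by linarith [pi_pos])
    (Continuous.continuousOn (by fun_prop)) (fun φ _ ↦ ?_)
    ⟨0, ⟨by linarith [pi_pos], pi_pos.le⟩, ?_⟩).ne' hint
  · rcases le_total (cos φ) 0 with hc | hc
    · rw [hsupp (x - y * sin φ, y * cos φ) (mul_nonpos_of_nonneg_of_nonpos hy.le hc), mul_zero]
    · have : √(y ^ 2 - (x - y * sin φ - x) ^ 2) = y * cos φ := by
        rw [← Real.sqrt_sq (mul_nonneg hy.le hc)]
        congr 1
        linear_combination (-y ^ 2) * sin_sq_add_cos_sq φ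
      rw [this]
      exact mul_self_nonneg _
  · simpa [Real.sqrt_sq hy.le] using mul_self_pos.2 hne

end CircleIntegrals

/-- Locality of the reconstruction (Theorem 1 of the paper): if the circular means
of `f` and `g` agree for all centers `p` with `|p - x| < ε` and all radii
`r ∈ [0, y]`, then `f(x,y) = g(x,y)`. -/
theorem reconstruction_is_local (f g : ℝ × ℝ → ℝ)
    (hf : ContDiff ℝ (⊤ : ℕ∞) f) (hfc : HasCompactSupport f)
    (hfs : tsupport f ⊆ {q : ℝ × ℝ | 0 < q.2})
    (hg : ContDiff ℝ (⊤ : ℕ∞) g) (hgc : HasCompactSupport g)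
    (hgs : tsupport g ⊆ {q : ℝ × ℝ | 0 < q.2})
    (x y ε : ℝ) (hy : 0 < y) (hε : 0 < ε)
    (h : ∀ p r : ℝ, |p - x| < ε → 0 ≤ r → r ≤ y → circMean f p r = circMean g p r) :
    f (x, y) = g (x, y) := by
  have huc {v : ℝ × ℝ → ℝ} (hv : ContDiff ℝ (⊤ : ℕ∞) v) : ContDiff ℝ 1 v :=
    hv.of_le (by exact_mod_cast le_top)
  have hlower {v : ℝ × ℝ → ℝ} (hv : tsupport v ⊆ {q : ℝ × ℝ | 0 < q.2}) (q : ℝ × ℝ)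
      (hq : q.2 ≤ 0) : v q = 0 :=
    image_eq_zero_of_notMem_tsupport fun hmem ↦ (hv hmem).not_ge hq
  refine sub_eq_zero.1 (eq_zero_of_integral_circle_eq_zero (u := fun q ↦ f q - g q)
    ((huc hf).sub (huc hg)) (fun q hq ↦ by simp [hlower hfs q hq, hlower hgs q hq]) hy hε
    fun p r hp hr hry ↦ ?_)
  have hfcont := hf.continuous
  have hgcont := hg.continuous
  rw [intervalIntegral.integral_sub (Continuous.intervalIntegrable (by fun_prop) _ _)
    (Continuous.intervalIntegrable (by fun_prop) _ _), sub_eq_zero]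
  exact mul_left_cancel₀ (by positivity) (h p r hp hr hry)
end
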